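/- Let (p,q) be admissible (1/p + 1/q = 1/2, p > 2) and suppose that for some s ∈ ℝ and C > 0 the Strichartz inequality ‖e^{−itP}u₀‖_{L^p([0,1]; L^q(𝕋²))} ≤ C‖u₀‖_{H^s(𝕋²)} holds for all u₀ ∈ H^s(𝕋²), where P = −∂ₓ² + ∂ᵧ². Assuming: (a) for f ∈ C^∞(𝕋) the function u₀(x,y) = f(x+y) satisfies e^{−itP}u₀ = u₀ for all t, and (b) ‖f(x+y)‖_{L^q(𝕋²)} = (2π)^{1/q}‖f‖_{L^q(𝕋)} and ‖f(x+y)‖_{H^s(𝕋²)} ≤ C'‖f‖_{H^s(𝕋)}. Then the one-dimensional Sobolev inequality ‖f‖_{L^q(𝕋)} ≤ C''‖f‖_{H^s(𝕋)} holds for all f ∈ C^∞(𝕋), and consequently s ≥ 1/p. -/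

import Mathlib

open Real MeasureTheory

/-- `m`-th Fourier coefficient of a `2π`-periodic function on the torus `𝕋`. -/
noncomputable def fourierCoeff1 (f : ℝ → ℂ) (m : ℤ) : ℂ :=
  (1 / (2 * π) : ℂ) * ∫ x in (-π)..π, Complex.exp (-Complex.I * m * x) * f x

/-- `(m,n)`-th Fourier coefficient of a doubly `2π`-periodic function on `𝕋²`. -/
noncomputable def fourierCoeff2 (u : ℝ → ℝ → ℂ) (m n : ℤ) : ℂ :=
  (1 / (2 * π) ^ 2 : ℂ) *
    ∫ x in (-π)..π, ∫ y in (-π)..π, Complex.exp (-Complex.I * (m * x + n * y)) * u x y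

/-- `L^q(𝕋)` norm, computed over one period. -/
noncomputable def LqNorm1 (q : ℝ) (f : ℝ → ℂ) : ℝ :=
  (∫ x in (-π)..π, ‖f x‖ ^ q) ^ (1/q)

/-- `L^q(𝕋²)` norm, computed over one period in each variable. -/
noncomputable def LqNorm2 (q : ℝ) (u : ℝ → ℝ → ℂ) : ℝ :=
  (∫ x in (-π)..π, ∫ y in (-π)..π, ‖u x y‖ ^ q) ^ (1/q)

/-- `H^s(𝕋)` norm via Fourier coefficients. -/
noncomputable def HsNorm1 (s : ℝ) (f : ℝ → ℂ) : ℝ :=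
  Real.sqrt (∑' m : ℤ, (1 + (m:ℝ)^2) ^ s * ‖fourierCoeff1 f m‖^2)

/-- `H^s(𝕋²)` norm via Fourier coefficients. -/
noncomputable def HsNorm2 (s : ℝ) (u : ℝ → ℝ → ℂ) : ℝ :=
  Real.sqrt (∑' p : ℤ × ℤ, (1 + (p.1:ℝ)^2 + (p.2:ℝ)^2) ^ s * ‖fourierCoeff2 u p.1 p.2‖^2)

lemma aux_int_exp (k : ℤ) :
    ∫ x in (-π)..π, Complex.exp (Complex.I * k * x) = if k = 0 then (2 * π : ℂ) else 0 := by
  split_ifs with h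
  · subst h
    simp
    ring
  · have hc : Complex.I * (k : ℂ) ≠ 0 := mul_ne_zero Complex.I_ne_zero (by exact_mod_cast h)
    rw [integral_exp_mul_complex hc]
    have h1 : Complex.exp (Complex.I * k * (π : ℝ)) = Complex.exp (Complex.I * k * ((-π : ℝ) : ℂ)) := by
      rw [Complex.exp_eq_exp_iff_exists_int]
      refine ⟨k, ?_⟩
      push_cast
      ring
    rw [h1]
    simp

lemma aux_fc2 (f : ℝ → ℂ) (hper : Function.Periodic f (2 * π)) (m n : ℤ) :
    fourierCoeff2 (fun x y => f (x + y)) m n = if m = n then fourierCoeff1 f n else 0 := by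
  have hg : Function.Periodic (fun z : ℝ => Complex.exp (-Complex.I * n * z) * f z) (2 * π) := by
    intro z
    have : Complex.exp (-Complex.I * n * ((z + 2 * π : ℝ) : ℂ)) = Complex.exp (-Complex.I * n * z) := by
      rw [Complex.exp_eq_exp_iff_exists_int]
      refine ⟨-n, ?_⟩
      push_cast
      ring
    simp only [this, hper z]
  have inner : ∀ x : ℝ, ∫ y in (-π)..π, Complex.exp (-Complex.I * (m * x + n * y)) * f (x + y)
      = Complex.exp (Complex.I * ((n - m : ℤ) : ℂ) * x) *
        ∫ z in (-π)..π, Complex.exp (-Complex.I * n * z) * f z := by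
    intro x
    have h1 : ∀ y : ℝ, Complex.exp (-Complex.I * (m * x + n * y)) * f (x + y)
      = Complex.exp (Complex.I * ((n - m : ℤ) : ℂ) * x) *
        (fun z : ℝ => Complex.exp (-Complex.I * n * z) * f z) (x + y) := by
      intro y
      simp only
      rw [← mul_assoc, ← Complex.exp_add]
      congr 2
      push_cast
      ring
    simp_rw [h1]
    rw [intervalIntegral.integral_const_mul]
    congr 1
    rw [intervalIntegral.integral_comp_add_left (fun z : ℝ => Complex.exp (-Complex.I * n * z) * f z)]
    have h2 := hg.intervalIntegral_add_eq (x + -π) (-π)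
    have e1 : x + -π + 2 * π = x + π := by ring
    have e2 : -π + 2 * π = π := by ring
    rw [e1, e2] at h2
    exact h2
  unfold fourierCoeff2
  simp_rw [inner]
  rw [intervalIntegral.integral_mul_const, aux_int_exp]
  have hpi : (π : ℂ) ≠ 0 := by exact_mod_cast Real.pi_ne_zero
  by_cases h : m = n
  · subst h
    simp only [sub_self, if_true]
    unfold fourierCoeff1
    field_simp
  · have : n - m ≠ 0 := by omega
    simp [h, this]

lemma aux_fc_deriv (f : ℝ → ℂ) (hf : ContDiff ℝ 1 f) (hper : Function.Periodic f (2 * π)) (m : ℤ) :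
    fourierCoeff1 (deriv f) m = (Complex.I * m) * fourierCoeff1 f m := by
  unfold fourierCoeff1
  have hd : ∀ x : ℝ, HasDerivAt (fun x : ℝ => Complex.exp (-Complex.I * m * x))
      (Complex.exp (-Complex.I * m * x) * (-Complex.I * m)) x := by
    intro x
    have := (((hasDerivAt_id (x : ℂ)).const_mul (-Complex.I * m)).cexp).comp_ofReal
    simpa using this
  have hfd : ∀ x : ℝ, HasDerivAt f (deriv f x) x := fun x =>
    (hf.differentiable one_ne_zero x).hasDerivAt
  have hc : Continuous (deriv f) := hf.continuous_deriv le_rfl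
  have key := intervalIntegral.integral_mul_deriv_eq_deriv_mul (a := -π) (b := π)
    (fun x _ => hd x) (fun x _ => hfd x)
    ((by fun_prop : Continuous fun x : ℝ =>
      Complex.exp (-Complex.I * m * x) * (-Complex.I * m)).intervalIntegrable _ _)
    (hc.intervalIntegrable _ _)
  rw [key]
  have h1 : Complex.exp (-Complex.I * m * (π : ℝ)) = Complex.exp (-Complex.I * m * ((-π : ℝ) : ℂ)) := by
    rw [Complex.exp_eq_exp_iff_exists_int]
    refine ⟨-m, ?_⟩
    push_cast
    ring
  have h2 : f π = f (-π) := by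
    rw [← hper (-π)]
    congr 1
    ring
  rw [h1, h2, sub_self, zero_sub]
  have h3 : ∀ x : ℝ, Complex.exp (-Complex.I * m * x) * (-Complex.I * m) * f x =
      (-Complex.I * m) * (Complex.exp (-Complex.I * m * x) * f x) := fun x => by ring
  simp_rw [h3]
  rw [intervalIntegral.integral_const_mul]
  ring

lemma aux_fc_iter (k : ℕ) : ∀ (f : ℝ → ℂ), ContDiff ℝ (⊤ : ℕ∞) f → Function.Periodic f (2 * π) →
    ∃ g : ℝ → ℂ, Continuous g ∧ ∀ m : ℤ, fourierCoeff1 g m = (Complex.I * m) ^ k * fourierCoeff1 f m := by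
  induction k with
  | zero => exact fun f hf _ => ⟨f, hf.continuous, fun m => by simp⟩
  | succ k ih =>
    intro f hf hper
    have hf' : ContDiff ℝ (⊤ : ℕ∞) (deriv f) := (contDiff_infty_iff_deriv.mp hf).2
    have hper' : Function.Periodic (deriv f) (2 * π) := by
      intro x
      rw [← deriv_comp_add_const]
      congr 1
      funext y
      exact hper y
    obtain ⟨g, hg, h⟩ := ih (deriv f) hf' hper'
    refine ⟨g, hg, fun m => ?_⟩
    rw [h, aux_fc_deriv f (hf.of_le (by exact_mod_cast le_top)) hper]
    ring

lemma aux_fc_bound (g : ℝ → ℂ) (hg : Continuous g) :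
    ∃ K : ℝ, ∀ m : ℤ, ‖fourierCoeff1 g m‖ ≤ K := by
  refine ⟨‖(1 / (2 * π) : ℂ)‖ * ∫ x in (-π)..π, ‖g x‖, fun m => ?_⟩
  unfold fourierCoeff1
  rw [norm_mul]
  gcongr
  refine (intervalIntegral.norm_integral_le_integral_norm (by linarith [Real.pi_pos])).trans ?_
  refine le_of_eq (intervalIntegral.integral_congr fun x _ => ?_)
  have : ‖Complex.exp (-Complex.I * m * x)‖ = 1 := by
    rw [Complex.norm_exp]
    simp
  simp only [norm_mul, this, one_mul]

lemma aux_summable (s : ℝ) (f : ℝ → ℂ) (hf : ContDiff ℝ (⊤ : ℕ∞) f)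
    (hper : Function.Periodic f (2 * π)) :
    Summable (fun m : ℤ => (1 + (m:ℝ)^2 + (m:ℝ)^2) ^ s * ‖fourierCoeff1 f m‖^2) := by
  obtain ⟨k, hk⟩ := exists_nat_ge s
  obtain ⟨g, hg, h⟩ := aux_fc_iter (k + 1) f hf hper
  obtain ⟨K, hK⟩ := aux_fc_bound g hg
  have hs : Summable (fun m : ℤ => (3 ^ k * K ^ 2) * (1 / (m:ℝ) ^ 2)) :=
    (Real.summable_one_div_int_pow.mpr (by norm_num)).mul_left _
  refine Summable.of_norm_bounded_eventually hs ?_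
  have : ({0}ᶜ : Set ℤ) ∈ Filter.cofinite := (Set.finite_singleton (0:ℤ)).compl_mem_cofinite
  filter_upwards [this] with m hm
  have hm0 : m ≠ 0 := hm
  have hm1 : (1:ℝ) ≤ (m:ℝ) ^ 2 := by
    have : 1 ≤ m ^ 2 := by have := sq_nonneg m; have := pow_ne_zero 2 hm0; omega
    exact_mod_cast this
  have hb := hK m
  rw [h m, norm_mul, norm_pow, norm_mul, Complex.norm_I, one_mul, Complex.norm_intCast] at hb
  have hsq : ((m:ℝ) ^ 2) ^ (k + 1) * ‖fourierCoeff1 f m‖ ^ 2 ≤ K ^ 2 := by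
    have h2 := pow_le_pow_left₀ (by positivity) hb 2
    calc _ = (|(m:ℝ)| ^ (k + 1) * ‖fourierCoeff1 f m‖) ^ 2 := by
          rw [mul_pow, ← sq_abs (m:ℝ), ← pow_mul, ← pow_mul, mul_comm 2]
      _ ≤ _ := h2
  have hx : (1 + (m:ℝ)^2 + (m:ℝ)^2) ^ s ≤ 3 ^ k * ((m:ℝ) ^ 2) ^ k := by
    calc (1 + (m:ℝ)^2 + (m:ℝ)^2) ^ s ≤ (1 + (m:ℝ)^2 + (m:ℝ)^2) ^ (k:ℝ) :=
          Real.rpow_le_rpow_of_exponent_le (by linarith) hk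
      _ = (1 + (m:ℝ)^2 + (m:ℝ)^2) ^ k := Real.rpow_natCast _ _
      _ ≤ (3 * (m:ℝ) ^ 2) ^ k := by
          apply pow_le_pow_left₀ (by positivity); linarith
      _ = _ := mul_pow _ _ _
  rw [Real.norm_of_nonneg (by positivity), mul_one_div, le_div_iff₀ (by linarith)]
  calc (1 + (m:ℝ)^2 + (m:ℝ)^2) ^ s * ‖fourierCoeff1 f m‖^2 * (m:ℝ)^2
      ≤ (3 ^ k * ((m:ℝ) ^ 2) ^ k) * ‖fourierCoeff1 f m‖^2 * (m:ℝ)^2 := by gcongr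
    _ = 3 ^ k * (((m:ℝ) ^ 2) ^ (k + 1) * ‖fourierCoeff1 f m‖ ^ 2) := by ring
    _ ≤ _ := by gcongr

lemma aux_summable2 (s : ℝ) (f : ℝ → ℂ) (hf : ContDiff ℝ (⊤ : ℕ∞) f)
    (hper : Function.Periodic f (2 * π)) :
    Summable (fun pr : ℤ × ℤ =>
        (1 + (pr.1:ℝ)^2 + (pr.2:ℝ)^2) ^ s *
          ‖fourierCoeff2 (fun x y => f (x + y)) pr.1 pr.2‖^2) := by
  have hinj : Function.Injective (fun m : ℤ => (m, m)) := fun a b h => (Prod.mk.inj h).1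
  rw [← hinj.summable_iff]
  · refine (aux_summable s f hf hper).congr fun m => ?_
    simp [aux_fc2 f hper]
  · rintro ⟨m, n⟩ hmn
    have : m ≠ n := by
      rintro rfl
      exact hmn ⟨m, rfl⟩
    simp [aux_fc2 f hper, this]

/-- One-sided Dirichlet kernel. -/
noncomputable def auxD (N : ℕ) (x : ℝ) : ℂ := ∑ k ∈ Finset.range N, Complex.exp (Complex.I * (k : ℤ) * x)

lemma auxD_smooth (N : ℕ) : ContDiff ℝ (⊤ : ℕ∞) (auxD N) := by
  unfold auxD
  refine ContDiff.sum fun k _ => ?_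
  exact (contDiff_const.mul Complex.ofRealCLM.contDiff).cexp

lemma auxD_per (N : ℕ) : Function.Periodic (auxD N) (2 * π) := by
  intro x
  unfold auxD
  refine Finset.sum_congr rfl fun k _ => ?_
  rw [Complex.exp_eq_exp_iff_exists_int]
  refine ⟨k, ?_⟩
  push_cast
  ring

lemma auxD_fc (N : ℕ) (m : ℤ) :
    fourierCoeff1 (auxD N) m = if m ∈ (Finset.range N).map Nat.castEmbedding then 1 else 0 := by
  unfold fourierCoeff1 auxD
  have h1 : ∀ x : ℝ, Complex.exp (-Complex.I * m * x) *
      ∑ k ∈ Finset.range N, Complex.exp (Complex.I * (k : ℤ) * x) =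
      ∑ k ∈ Finset.range N, Complex.exp (Complex.I * ((k - m : ℤ) : ℂ) * x) := by
    intro x
    rw [Finset.mul_sum]
    refine Finset.sum_congr rfl fun k _ => ?_
    rw [← Complex.exp_add]
    congr 1
    push_cast
    ring
  simp_rw [h1]
  rw [intervalIntegral.integral_finsetSum
    (fun (k : ℕ) _ => (by fun_prop : Continuous fun x : ℝ =>
      Complex.exp (Complex.I * (((k : ℤ) - m : ℤ) : ℂ) * x)).intervalIntegrable _ _)]
  simp_rw [aux_int_exp]
  have hpi : (π : ℂ) ≠ 0 := by exact_mod_cast Real.pi_ne_zero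
  split_ifs with h
  · simp only [Finset.mem_map, Finset.mem_range, Nat.castEmbedding_apply] at h
    obtain ⟨a, ha, rfl⟩ := h
    rw [Finset.sum_eq_single a]
    · simp
      field_simp
    · intro b _ hb
      rw [if_neg]
      omega
    · intro h
      exact absurd (Finset.mem_range.mpr ha) h
  · rw [Finset.sum_eq_zero, mul_zero]
    intro k hk
    rw [if_neg]
    intro h0
    exact h (Finset.mem_map.mpr ⟨k, hk, by simp; omega⟩)

lemma auxD_Hs (s : ℝ) (N : ℕ) (hN : 1 ≤ N) :
    HsNorm1 s (auxD N) ≤ 2 ^ (max s 0 / 2) * (N:ℝ) ^ (1 / 2 + max s 0) := by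
  have hN' : (1:ℝ) ≤ N := by exact_mod_cast hN
  have hN0 : (0:ℝ) < N := by linarith
  unfold HsNorm1
  refine Real.sqrt_le_iff.mpr ⟨by positivity, ?_⟩
  rw [tsum_eq_sum (s := (Finset.range N).map Nat.castEmbedding)
    (by intro m hm; rw [auxD_fc, if_neg hm]; simp)]
  rw [Finset.sum_map]
  have hb : ∀ k ∈ Finset.range N, (1 + (((Nat.castEmbedding k : ℤ)):ℝ)^2) ^ s *
      ‖fourierCoeff1 (auxD N) (Nat.castEmbedding k : ℤ)‖^2 ≤ (2 * (N:ℝ)^2) ^ (max s 0) := by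
    intro k hk
    rw [auxD_fc, if_pos (Finset.mem_map_of_mem _ hk)]
    have hk' : (k:ℝ) ≤ N := by exact_mod_cast (Finset.mem_range.mp hk).le
    have hk2 : (k:ℝ)^2 ≤ (N:ℝ)^2 := by gcongr
    simp only [Nat.castEmbedding_apply, Int.cast_natCast, norm_one, one_pow, mul_one]
    calc (1 + (k:ℝ)^2) ^ s ≤ (1 + (k:ℝ)^2) ^ (max s 0) :=
          Real.rpow_le_rpow_of_exponent_le (by nlinarith [sq_nonneg (k:ℝ)]) (le_max_left _ _)
      _ ≤ _ := Real.rpow_le_rpow (by positivity) (by nlinarith) (le_max_right _ _)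
  refine (Finset.sum_le_sum hb).trans (le_of_eq ?_)
  rw [Finset.sum_const, Finset.card_range, nsmul_eq_mul, Real.mul_rpow (by norm_num) (by positivity),
    mul_pow, ← Real.rpow_natCast, ← Real.rpow_natCast (_ ^ _), ← Real.rpow_natCast (_ ^ _),
    ← Real.rpow_mul (by positivity), ← Real.rpow_mul (by positivity), ← Real.rpow_mul (by positivity)]
  rw [mul_left_comm]
  nth_rewrite 1 [← Real.rpow_one (N:ℝ)]
  rw [← Real.rpow_add hN0]
  congr 2 <;> push_cast <;> ring

lemma auxD_Lq (q : ℝ) (hq : 0 < q) (N : ℕ) (hN : 1 ≤ N) :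
    (N:ℝ) / 2 * (N:ℝ) ^ (-(1/q)) ≤ LqNorm1 q (auxD N) := by
  have hN' : (1:ℝ) ≤ N := by exact_mod_cast hN
  have hN0 : (0:ℝ) < N := by linarith
  have hlow : ∀ x ∈ Set.Icc (0:ℝ) (1/N), (N:ℝ)/2 ≤ ‖auxD N x‖ := by
    intro x hx
    refine le_trans ?_ (Complex.re_le_norm _)
    unfold auxD
    rw [Complex.re_sum]
    have : ∀ k ∈ Finset.range N, (1/2:ℝ) ≤ (Complex.exp (Complex.I * (k : ℤ) * x)).re := by
      intro k hk
      have hk' : (k:ℝ) ≤ N := by exact_mod_cast (Finset.mem_range.mp hk).le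
      have e : Complex.I * ((k : ℤ) : ℂ) * x = ((k * x : ℝ) : ℂ) * Complex.I := by
        push_cast; ring
      rw [e, Complex.exp_ofReal_mul_I_re]
      have h0 : 0 ≤ (k:ℝ) * x := mul_nonneg (by positivity) hx.1
      have h1 : (k:ℝ) * x ≤ 1 := by
        calc (k:ℝ) * x ≤ N * (1 / N) := by
              apply mul_le_mul hk' hx.2 hx.1 hN0.le
          _ = 1 := by field_simp
      have := Real.one_sub_sq_div_two_le_cos (x := (k:ℝ) * x)
      nlinarith
    have := Finset.sum_le_sum this
    simp only [Finset.sum_const, Finset.card_range, nsmul_eq_mul] at this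
    linarith
  have hcont : Continuous fun x => ‖auxD N x‖ ^ q :=
    (auxD_smooth N).continuous.norm.rpow_const fun _ => Or.inr hq.le
  have hpi := Real.pi_gt_three
  have hN1 : (1:ℝ)/N ≤ 1 := by rw [div_le_one hN0]; exact hN'
  have hint : (1/N) * ((N:ℝ)/2) ^ q ≤ ∫ x in (-π)..π, ‖auxD N x‖ ^ q := by
    calc (1/N) * ((N:ℝ)/2) ^ q = ∫ x in (0:ℝ)..(1/N), ((N:ℝ)/2) ^ q := by simp
      _ ≤ ∫ x in (0:ℝ)..(1/N), ‖auxD N x‖ ^ q := by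
          refine intervalIntegral.integral_mono_on (by positivity) (by simp)
            (hcont.intervalIntegrable _ _) fun x hx => ?_
          exact Real.rpow_le_rpow (by positivity) (hlow x hx) hq.le
      _ ≤ _ := by
          refine intervalIntegral.integral_mono_interval (by linarith) (by positivity) (by linarith)
            (Filter.Eventually.of_forall fun x => by positivity) (hcont.intervalIntegrable _ _)
  unfold LqNorm1
  refine le_trans (le_of_eq ?_) (Real.rpow_le_rpow (by positivity) hint (by positivity))
  rw [Real.mul_rpow (by positivity) (by positivity), ← Real.rpow_mul (by positivity),
    mul_one_div_cancel hq.ne', Real.rpow_one, one_div (N:ℝ), Real.inv_rpow hN0.le,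
    Real.rpow_neg hN0.le]
  ring

/-- If `(p,q)` is admissible and the Strichartz inequality
`‖e^{-itP}u₀‖_{L^p([0,1];L^q(𝕋²))} ≤ C‖u₀‖_{H^s(𝕋²)}` holds, then — assuming
(a) functions of the form `u₀(x,y) = f(x+y)` are stationary under `e^{-itP}`, and
(b) the compatibility of the norms of `f(x+y)` with those of `f` — the one-dimensional
Sobolev inequality `‖f‖_{L^q(𝕋)} ≤ C''‖f‖_{H^s(𝕋)}` holds for all `f ∈ C^∞(𝕋)`, and
consequently `s ≥ 1/p`. -/
theorem strichartz_implies_sobolev_and_lower_bound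
    (p q s C : ℝ) (hp : 2 < p) (hpq : 1/p + 1/q = 1/2) (hC : 0 < C)
    (U : ℝ → (ℝ → ℝ → ℂ) → (ℝ → ℝ → ℂ))
    (hStri : ∀ u₀ : ℝ → ℝ → ℂ,
      Summable (fun pr : ℤ × ℤ =>
        (1 + (pr.1:ℝ)^2 + (pr.2:ℝ)^2) ^ s * ‖fourierCoeff2 u₀ pr.1 pr.2‖^2) →
      (∫ t in (0:ℝ)..1, LqNorm2 q (U t u₀) ^ p) ^ (1/p) ≤ C * HsNorm2 s u₀)
    (ha : ∀ f : ℝ → ℂ, ContDiff ℝ (⊤ : ℕ∞) f → Function.Periodic f (2 * π) →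
      ∀ t : ℝ, U t (fun x y => f (x + y)) = fun x y => f (x + y))
    (hb1 : ∀ f : ℝ → ℂ, ContDiff ℝ (⊤ : ℕ∞) f → Function.Periodic f (2 * π) →
      LqNorm2 q (fun x y => f (x + y)) = (2 * π) ^ (1/q) * LqNorm1 q f)
    (hb2 : ∃ C' : ℝ, 0 < C' ∧ ∀ f : ℝ → ℂ, ContDiff ℝ (⊤ : ℕ∞) f → Function.Periodic f (2 * π) →
      HsNorm2 s (fun x y => f (x + y)) ≤ C' * HsNorm1 s f) :
    (∃ C'' : ℝ, 0 < C'' ∧ ∀ f : ℝ → ℂ, ContDiff ℝ (⊤ : ℕ∞) f → Function.Periodic f (2 * π) →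
      LqNorm1 q f ≤ C'' * HsNorm1 s f) ∧ 1/p ≤ s := by
  have hp0 : 0 < p := by linarith
  have hq1 : 0 < 1 / q := by
    have : 1 / p < 1 / 2 := one_div_lt_one_div_of_lt (by norm_num) hp
    linarith
  have hq : 0 < q := one_div_pos.mp hq1
  have part1 : ∃ C'' : ℝ, 0 < C'' ∧ ∀ f : ℝ → ℂ, ContDiff ℝ (⊤ : ℕ∞) f →
      Function.Periodic f (2 * π) → LqNorm1 q f ≤ C'' * HsNorm1 s f := by
    obtain ⟨C', hC', hb2⟩ := hb2
    have hA : 0 < (2 * π) ^ (1/q) := by positivity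
    refine ⟨C * C' / (2 * π) ^ (1/q), by positivity, fun f hf hper => ?_⟩
    have h1 := hStri _ (aux_summable2 s f hf hper)
    simp_rw [ha f hf hper] at h1
    have hL : 0 ≤ LqNorm1 q f := by
      unfold LqNorm1
      refine Real.rpow_nonneg (intervalIntegral.integral_nonneg (by linarith [Real.pi_pos])
        fun x _ => by positivity) _
    rw [hb1 f hf hper, intervalIntegral.integral_const, sub_zero, one_smul,
      ← Real.rpow_mul (by positivity), mul_one_div_cancel hp0.ne', Real.rpow_one] at h1
    have h2 := mul_le_mul_of_nonneg_left (hb2 f hf hper) hC.le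
    rw [div_mul_eq_mul_div, le_div_iff₀ hA]
    linarith
  refine ⟨part1, ?_⟩
  obtain ⟨K, hK, hSob⟩ := part1
  by_contra! hs
  have hσ : max s 0 < 1 / p := max_lt hs (by positivity)
  have hbd : ∀ N : ℕ, 1 ≤ N → (N:ℝ) ^ (1 / p - max s 0) ≤ 2 * (K * 2 ^ (max s 0 / 2)) := by
    intro N hN
    have hN0 : (0:ℝ) < N := by exact_mod_cast hN
    have h1 := (auxD_Lq q hq N hN).trans (hSob _ (auxD_smooth N) (auxD_per N))
    have h2 := mul_le_mul_of_nonneg_left (auxD_Hs s N hN) hK.le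
    have h3 : (N:ℝ) ^ (1 / p - max s 0) * (N:ℝ) ^ (1 / 2 + max s 0) = N * (N:ℝ) ^ (-(1/q)) := by
      nth_rewrite 3 [← Real.rpow_one (N:ℝ)]
      rw [← Real.rpow_add hN0, ← Real.rpow_add hN0]
      congr 1
      linarith
    have h4 : 0 < (N:ℝ) ^ (1 / 2 + max s 0) := by positivity
    refine le_of_mul_le_mul_right ?_ h4
    rw [h3]
    linarith
  have ht := (tendsto_rpow_atTop (sub_pos.mpr hσ)).comp (tendsto_natCast_atTop_atTop (R := ℝ))
  obtain ⟨N, hN, hN1⟩ := ((ht.eventually_gt_atTop (2 * (K * 2 ^ (max s 0 / 2)))).and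
    (Filter.eventually_ge_atTop 1)).exists
  exact absurd (hbd N hN1) (not_le.mpr hN)
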